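/- arXiv:2103.00060 — 7 statements merged into one kernel-verified Lean document; each statement's English description precedes it below -/
import Mathlib

section
/- For all positive real numbers w1, w2, w3, T and all positive reals b1, b2, one has w3/(T·b1·b2) + (w1·b1^2 + w2·b2^2)^2 ≥ 3·(w1·w2·w3^2)^(1/3)·T^(-2/3). -/
open Real

/-- A cubic form of the weighted AM-GM inequality: if `c ^ 3 = a ^ 2 * b` then
`3 * c ≤ 2 * a + b`. -/
theorem three_mul_le_of_cube_eq {a b c : ℝ} (ha : 0 ≤ a) (hb : 0 ≤ b)
    (h : c ^ 3 = a ^ 2 * b) : 3 * c ≤ 2 * a + b := by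
  refine le_of_pow_le_pow_left₀ (n := 3) (by norm_num) (by positivity) ?_
  have hab : 0 ≤ (a - b) ^ 2 * (8 * a + b) := by positivity
  linear_combination hab + 27 * h

/-- The joint MSE objective `g(b1,b2) = w3/(T·b1·b2) + (w1·b1² + w2·b2²)²` is bounded
below by `3·(w1·w2·w3²)^(1/3)·T^(-2/3)` on `(0,∞)²`. -/
theorem joint_mse_lower_bound (w1 w2 w3 T b1 b2 : ℝ)
    (hw1 : 0 < w1) (hw2 : 0 < w2) (hw3 : 0 < w3) (hT : 0 < T)
    (hb1 : 0 < b1) (hb2 : 0 < b2) :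
    3 * (w1 * w2 * w3 ^ 2) ^ ((1 : ℝ) / 3) * T ^ (-(2 : ℝ) / 3) ≤
      w3 / (T * b1 * b2) + (w1 * b1 ^ 2 + w2 * b2 ^ 2) ^ 2 := by
  have hW : ((w1 * w2 * w3 ^ 2) ^ ((1 : ℝ) / 3)) ^ 3 = w1 * w2 * w3 ^ 2 := by
    rw [← rpow_mul_natCast (by positivity)]
    norm_num
  have hT3 : (T ^ (-(2 : ℝ) / 3)) ^ 3 = (T ^ 2)⁻¹ := by
    rw [← rpow_mul_natCast hT.le, ← rpow_natCast T 2, ← rpow_neg hT.le]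
    norm_num
  have hcube : ((w1 * w2 * w3 ^ 2) ^ ((1 : ℝ) / 3) * T ^ (-(2 : ℝ) / 3)) ^ 3 =
      (w3 / (2 * (T * b1 * b2))) ^ 2 * (4 * w1 * w2 * (b1 * b2) ^ 2) := by
    rw [mul_pow, hW, hT3]
    field_simp
    norm_num
  have hamgm := three_mul_le_of_cube_eq (by positivity) (by positivity) hcube
  have hhalf : 2 * (w3 / (2 * (T * b1 * b2))) = w3 / (T * b1 * b2) := by
    field_simp
  have hsq : 4 * w1 * w2 * (b1 * b2) ^ 2 ≤ (w1 * b1 ^ 2 + w2 * b2 ^ 2) ^ 2 := by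
    linear_combination sq_nonneg (w1 * b1 ^ 2 - w2 * b2 ^ 2)
  rw [mul_assoc]
  linarith
end

section
/- For positive reals b1, b2, equality g(b1, b2) = 3·(w1·w2·w3^2)^(1/3)·T^(-2/3) holds if and only if b1 = T^(-1/6)·(w2/w1^5)^(1/12)·(w3/8)^(1/6) and b2 = T^(-1/6)·(w1/w2^5)^(1/12)·(w3/8)^(1/6); that is, the joint MSE objective has a unique global minimizer on (0,∞)^2. -/
open Real

/-- The equality case of the weighted arithmetic-geometric mean inequality
`27 u² p q ≤ (u + (p + q)²)³`. -/
lemma add_sq_cube_eq_iff {u p q : ℝ} (hu : 0 < u) (hp : 0 < p) (hq : 0 < q) :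
    (u + (p + q) ^ 2) ^ 3 = 27 * (u ^ 2 * p * q) ↔ p = q ∧ u = 8 * p ^ 2 := by
  constructor
  · intro h
    have hsum : ((p + q) ^ 2 - u / 2) ^ 2 * ((p + q) ^ 2 + 4 * u)
        + 27 / 4 * (u * (p - q)) ^ 2 = 0 := by
      linear_combination h
    have h1 : 0 ≤ ((p + q) ^ 2 - u / 2) ^ 2 * ((p + q) ^ 2 + 4 * u) := by positivity
    have hpq : (u * (p - q)) ^ 2 = 0 := by nlinarith [sq_nonneg (u * (p - q))]
    have hru : ((p + q) ^ 2 - u / 2) ^ 2 * ((p + q) ^ 2 + 4 * u) = 0 := by linarith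
    have hpq' : p - q = 0 :=
      (mul_eq_zero.mp (pow_eq_zero_iff two_ne_zero |>.mp hpq)).resolve_left hu.ne'
    have hru' : (p + q) ^ 2 - u / 2 = 0 :=
      pow_eq_zero_iff two_ne_zero |>.mp ((mul_eq_zero.mp hru).resolve_right (by positivity))
    obtain rfl : p = q := sub_eq_zero.mp hpq'
    exact ⟨rfl, by linear_combination -2 * hru'⟩
  · rintro ⟨rfl, rfl⟩
    ring

/-- A positive real equals the closed-form bandwidth iff its twelfth power does. -/
lemma eq_bandwidth_iff {a c w T b : ℝ} (ha : 0 < a) (hc : 0 < c) (hw : 0 < w) (hT : 0 < T)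
    (hb : 0 < b) :
    b = T ^ (-(1 : ℝ) / 6) * (a / c ^ 5) ^ ((1 : ℝ) / 12) * (w / 8) ^ ((1 : ℝ) / 6) ↔
      64 * T ^ 2 * c ^ 5 * b ^ 12 = a * w ^ 2 := by
  have hpow : (T ^ (-(1 : ℝ) / 6) * (a / c ^ 5) ^ ((1 : ℝ) / 12) * (w / 8) ^ ((1 : ℝ) / 6)) ^ 12
      = a * w ^ 2 / (64 * T ^ 2 * c ^ 5) := by
    have h1 : (T ^ (-(1 : ℝ) / 6)) ^ 12 = (T ^ 2)⁻¹ := by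
      rw [← rpow_mul_natCast hT.le, ← rpow_natCast T 2, ← rpow_neg hT.le]
      norm_num
    have h2 : ((a / c ^ 5) ^ ((1 : ℝ) / 12)) ^ 12 = a / c ^ 5 := by
      rw [← rpow_mul_natCast (by positivity)]
      norm_num
    have h3 : ((w / 8) ^ ((1 : ℝ) / 6)) ^ 12 = (w / 8) ^ 2 := by
      rw [← rpow_mul_natCast (by positivity), ← rpow_natCast _ 2]
      norm_num
    rw [mul_pow, mul_pow, h1, h2, h3]
    field_simp
    norm_num
  rw [← pow_left_inj₀ hb.le (by positivity) (by norm_num : (12 : ℕ) ≠ 0), hpow,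
    eq_div_iff (by positivity), mul_comm]

/-- The joint MSE objective attains the global lower bound `3·(w1·w2·w3²)^(1/3)·T^(-2/3)`
at `(b1,b2) ∈ (0,∞)²` if and only if `(b1,b2)` is the pair of optimal simultaneous
bandwidths; i.e. the global minimizer is unique. -/
theorem joint_mse_unique_minimizer (w1 w2 w3 T : ℝ)
    (hw1 : 0 < w1) (hw2 : 0 < w2) (hw3 : 0 < w3) (hT : 0 < T)
    (b1 b2 : ℝ) (hb1 : 0 < b1) (hb2 : 0 < b2) :
    (w3 / (T * b1 * b2) + (w1 * b1 ^ 2 + w2 * b2 ^ 2) ^ 2 =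
      3 * (w1 * w2 * w3 ^ 2) ^ ((1 : ℝ) / 3) * T ^ (-(2 : ℝ) / 3)) ↔
    (b1 = T ^ (-(1 : ℝ) / 6) * (w2 / w1 ^ 5) ^ ((1 : ℝ) / 12) * (w3 / 8) ^ ((1 : ℝ) / 6) ∧
     b2 = T ^ (-(1 : ℝ) / 6) * (w1 / w2 ^ 5) ^ ((1 : ℝ) / 12) * (w3 / 8) ^ ((1 : ℝ) / 6)) := by
  set u := w3 / (T * b1 * b2) with hu_def
  have hu : 0 < u := by positivity
  have huT : u * (T * b1 * b2) = w3 := div_mul_cancel₀ _ (by positivity)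
  have hp : 0 < w1 * b1 ^ 2 := by positivity
  have hq : 0 < w2 * b2 ^ 2 := by positivity
  have hmin : (3 * (w1 * w2 * w3 ^ 2) ^ ((1 : ℝ) / 3) * T ^ (-(2 : ℝ) / 3)) ^ 3
      = 27 * (u ^ 2 * (w1 * b1 ^ 2) * (w2 * b2 ^ 2)) := by
    have h1 : ((w1 * w2 * w3 ^ 2) ^ ((1 : ℝ) / 3)) ^ 3 = w1 * w2 * w3 ^ 2 := by
      rw [← rpow_mul_natCast (by positivity)]
      norm_num
    have h2 : (T ^ (-(2 : ℝ) / 3)) ^ 3 = (T ^ 2)⁻¹ := by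
      rw [← rpow_mul_natCast hT.le, ← rpow_natCast T 2, ← rpow_neg hT.le]
      norm_num
    rw [mul_pow, mul_pow, h1, h2, ← huT]
    field_simp
    norm_num
  rw [← pow_left_inj₀ (by positivity) (by positivity) (three_ne_zero : (3 : ℕ) ≠ 0), hmin,
    add_sq_cube_eq_iff hu hp hq, eq_bandwidth_iff hw2 hw1 hw3 hT hb1,
    eq_bandwidth_iff hw1 hw2 hw3 hT hb2, ← huT]
  constructor
  · rintro ⟨hpq, hu8⟩
    rw [hu8]
    constructor
    · linear_combination 64 * T ^ 2 * w1 ^ 4 * b1 ^ 10 * hpq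
    · have h4 : (w1 * b1 ^ 2) ^ 5 = (w2 * b2 ^ 2) ^ 5 := by rw [hpq]
      linear_combination -64 * T ^ 2 * b2 ^ 2 * h4
  · rintro ⟨h1, h2⟩
    have hpq : w1 * b1 ^ 2 = w2 * b2 ^ 2 := by
      refine (pow_left_inj₀ hp.le hq.le (by norm_num : (6 : ℕ) ≠ 0)).mp ?_
      refine mul_left_cancel₀ (by positivity : 64 * T ^ 2 ≠ 0) ?_
      linear_combination w1 * h1 - w2 * h2
    refine ⟨hpq, (pow_left_inj₀ hu.le (by positivity) two_ne_zero).mp ?_⟩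
    refine mul_left_cancel₀ (by positivity : T ^ 2 * b1 ^ 2 * (w2 * b2 ^ 2) ≠ 0) ?_
    linear_combination -h1 + 64 * T ^ 2 * w1 ^ 4 * b1 ^ 10 * hpq
end

section
/- Fix q > 0 and constants w1, w2, w3, T > 0. Set A = (2·w2/(q·w1))^(1/q) and D = w3/(4·(1 + 2/q)·w2^2), and define b2° = (D/(T·A))^(q/(2+5q)) and b1° = A·(b2°)^(2/q). Then both partial derivatives of g_q(b1, b2) = w3/(T·b1·b2) + (w1·b1^q + w2·b2^2)^2 vanish at (b1°, b2°); moreover b1° equals a constant (depending only on w1, w2, w3, q) times T^(-2/(2+5q)) and b2° equals a constant times T^(-q/(2+5q)). -/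
open Real

/-- The variance term `c / (k x)` of the objective has derivative `-c / (k x ^ 2)`. -/
theorem hasDerivAt_const_div_const_mul (c : ℝ) {k x : ℝ} (hk : k ≠ 0) (hx : x ≠ 0) :
    HasDerivAt (fun y : ℝ => c / (k * y)) (-c / (k * x ^ 2)) x := by
  have h := (hasDerivAt_const x c).div ((hasDerivAt_id x).const_mul k) (mul_ne_zero hk hx)
  refine h.congr_deriv ?_
  simp only [id]
  field_simp
  ring

/-- General-`q` optimal bandwidths: with `A = (2w2/(q·w1))^(1/q)`,
`D = w3/(4(1+2/q)w2²)`, `b2° = (D/(T·A))^(q/(2+5q))` and `b1° = A·(b2°)^(2/q)`,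
both partial derivatives of `g_q(b1,b2) = w3/(T·b1·b2) + (w1·b1^q + w2·b2²)²` vanish at
`(b1°, b2°)`, and `b1°`, `b2°` equal constants (depending only on `w1,w2,w3,q`)
times `T^(-2/(2+5q))` and `T^(-q/(2+5q))` respectively. -/
theorem general_q_optimal_bandwidths (q w1 w2 w3 : ℝ)
    (hq : 0 < q) (hw1 : 0 < w1) (hw2 : 0 < w2) (hw3 : 0 < w3) :
    ∃ C1 C2 : ℝ, ∀ T : ℝ, 0 < T →
      ∀ A D b2o b1o : ℝ,
        A = (2 * w2 / (q * w1)) ^ (1 / q) →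
        D = w3 / (4 * (1 + 2 / q) * w2 ^ 2) →
        b2o = (D / (T * A)) ^ (q / (2 + 5 * q)) →
        b1o = A * b2o ^ (2 / q) →
        HasDerivAt
          (fun b1 : ℝ => w3 / (T * b1 * b2o) + (w1 * b1 ^ q + w2 * b2o ^ 2) ^ 2) 0 b1o ∧
        HasDerivAt
          (fun b2 : ℝ => w3 / (T * b1o * b2) + (w1 * b1o ^ q + w2 * b2 ^ 2) ^ 2) 0 b2o ∧
        b1o = C1 * T ^ (-(2 / (2 + 5 * q))) ∧
        b2o = C2 * T ^ (-(q / (2 + 5 * q))) := by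
  refine ⟨(2 * w2 / (q * w1)) ^ (1 / q) *
      ((w3 / (4 * (1 + 2 / q) * w2 ^ 2) / (2 * w2 / (q * w1)) ^ (1 / q)) ^
        (q / (2 + 5 * q))) ^ (2 / q),
    (w3 / (4 * (1 + 2 / q) * w2 ^ 2) / (2 * w2 / (q * w1)) ^ (1 / q)) ^ (q / (2 + 5 * q)), ?_⟩
  intro T hT A D b2 b1 hA hD hb2 hb1
  rw [← hA, ← hD]
  have hA0 : 0 < A := by rw [hA]; positivity
  have hD0 : 0 < D := by rw [hD]; positivity
  have hb20 : 0 < b2 := by rw [hb2]; positivity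
  have hb10 : 0 < b1 := by rw [hb1]; positivity
  have hAq : A ^ q = 2 * w2 / (q * w1) := by
    rw [hA, ← rpow_mul (by positivity), one_div_mul_cancel hq.ne', rpow_one]
  have hb1q : b1 ^ q = 2 * w2 / (q * w1) * b2 ^ 2 := by
    rw [hb1, mul_rpow hA0.le (by positivity), hAq, ← rpow_mul hb20.le,
      div_mul_cancel₀ _ hq.ne', rpow_two]
  have hprod : b1 * b2 ^ 5 = D / T := by
    have hpow : b2 ^ (2 / q) * b2 ^ 5 = D / (T * A) := by
      rw [← rpow_natCast b2 5, ← rpow_add hb20, hb2, ← rpow_mul (by positivity)]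
      have he : q / (2 + 5 * q) * (2 / q + ((5 : ℕ) : ℝ)) = 1 := by
        push_cast
        field_simp
      rw [he, rpow_one]
    rw [hb1, mul_assoc, hpow]
    field_simp
  have hw3 : w3 = 4 * (1 + 2 / q) * w2 ^ 2 * T * (b1 * b2 ^ 5) := by
    rw [hprod, hD]
    field_simp
  have hb2T : b2 = (D / A) ^ (q / (2 + 5 * q)) * T ^ (-(q / (2 + 5 * q))) := by
    rw [hb2, rpow_neg hT.le, ← inv_rpow hT.le, ← mul_rpow (by positivity) (by positivity)]
    congr 1
    field_simp
  refine ⟨?_, ?_, ?_, hb2T⟩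
  · have h1 := hasDerivAt_const_div_const_mul w3 (mul_pos hT hb20).ne' hb10.ne'
    have h2 := ((((hasDerivAt_rpow_const (p := q) (Or.inl hb10.ne')).const_mul w1).add_const
      (w2 * b2 ^ 2)).pow 2)
    refine ((h1.add h2).congr_deriv ?_).congr_of_eventuallyEq (.of_forall fun x => ?_)
    · rw [rpow_sub_one hb10.ne', hb1q, hw3]
      simp only [Nat.cast_ofNat, Nat.add_one_sub_one, pow_one]
      field_simp
      ring
    · simp [mul_right_comm]
  · have h1 := hasDerivAt_const_div_const_mul w3 (mul_pos hT hb10).ne' hb20.ne'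
    have h2 := ((((hasDerivAt_pow 2 b2).const_mul w2).const_add (w1 * b1 ^ q)).pow 2)
    refine ((h1.add h2).congr_deriv ?_).congr_of_eventuallyEq (.of_forall fun x => ?_)
    · rw [hb1q, hw3]
      simp only [Nat.cast_ofNat, Nat.add_one_sub_one, pow_one]
      field_simp
      ring
    · simp
  · have he : -(q / (2 + 5 * q)) * (2 / q) = -(2 / (2 + 5 * q)) := by
      field_simp
    rw [hb1, hb2T, mul_rpow (by positivity) (by positivity), ← rpow_mul hT.le, he, mul_assoc]
end

section
/- Let f : ℝ → [0,∞) be measurable with ∫ f = 1, ∫ x·f(x) dx = 0, ∫ x^2·f(x) dx < ∞ and ∫ f(x)^2 dx < ∞. Then (∫ f(x)^2 dx)^2 · (∫ x^2·f(x) dx) ≥ 9/125, and equality holds for the Epanechnikov (parabolic) density f(x) = (3/4)·(1 − x^2) for |x| ≤ 1 and f(x) = 0 otherwise. -/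
open Real MeasureTheory

/-- The Epanechnikov (parabolic) density `(3/4)(1 - x²)` on `[-1,1]`. -/
noncomputable def epanechnikov (x : ℝ) : ℝ := if |x| ≤ 1 then (3 / 4) * (1 - x ^ 2) else 0

lemma integral_comp_epanechnikov (g : ℝ → ℝ → ℝ) (hg : ∀ x, g x 0 = 0) :
    ∫ x, g x (epanechnikov x) = ∫ x in (-1 : ℝ)..1, g x (3 / 4 * (1 - x ^ 2)) := by
  rw [intervalIntegral.integral_of_le (by norm_num), ← integral_Icc_eq_integral_Ioc,
    ← integral_indicator measurableSet_Icc]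
  refine integral_congr_ae (.of_forall fun x => ?_)
  by_cases h : |x| ≤ 1
  · simp [epanechnikov, h, Set.indicator, abs_le.1 h]
  · simp [epanechnikov, h, Set.indicator, ← abs_le, hg]

lemma integral_epanechnikov_sq : ∫ x, epanechnikov x ^ 2 = 3 / 5 := by
  rw [integral_comp_epanechnikov (fun _ y => y ^ 2) (by simp)]
  have h (x : ℝ) : HasDerivAt (fun x : ℝ => 9 / 16 * (x - 2 / 3 * x ^ 3 + x ^ 5 / 5))
      ((3 / 4 * (1 - x ^ 2)) ^ 2) x := by
    refine ((((hasDerivAt_id' x).fun_sub ((hasDerivAt_pow 3 x).const_mul (2 / 3))).fun_add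
      ((hasDerivAt_pow 5 x).div_const 5)).const_mul (9 / 16)).congr_deriv ?_
    norm_num
    ring
  rw [intervalIntegral.integral_eq_sub_of_hasDerivAt (fun x _ => h x)
    (Continuous.intervalIntegrable (by fun_prop) _ _)]
  norm_num

lemma integral_sq_mul_epanechnikov : ∫ x, x ^ 2 * epanechnikov x = 1 / 5 := by
  rw [integral_comp_epanechnikov (fun x y => x ^ 2 * y) (by simp)]
  have h (x : ℝ) : HasDerivAt (fun x : ℝ => 3 / 4 * (x ^ 3 / 3 - x ^ 5 / 5))
      (x ^ 2 * (3 / 4 * (1 - x ^ 2))) x := by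
    refine ((((hasDerivAt_pow 3 x).div_const 3).fun_sub
      ((hasDerivAt_pow 5 x).div_const 5)).const_mul (3 / 4)).congr_deriv ?_
    norm_num
    ring
  rw [intervalIntegral.integral_eq_sub_of_hasDerivAt (fun x _ => h x)
    (Continuous.intervalIntegrable (by fun_prop) _ _)]
  norm_num

lemma integrable_epanechnikov_sq : Integrable fun x => epanechnikov x ^ 2 :=
  not_imp_comm.1 integral_undef (by rw [integral_epanechnikov_sq]; norm_num)

lemma le_epanechnikov (x : ℝ) : 3 / 4 * (1 - x ^ 2) ≤ epanechnikov x := by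
  unfold epanechnikov
  split_ifs with h
  · rfl
  · have := (one_lt_sq_iff_one_lt_abs x).2 (not_le.1 h)
    linarith

/-- Comparison of a density with the Epanechnikov density of half-width `a`. -/
lemma le_integral_sq_of_density {f : ℝ → ℝ} (hnn : ∀ x, 0 ≤ f x)
    (hint : Integrable f) (htotal : ∫ x, f x = 1)
    (hx2 : Integrable (fun x => x ^ 2 * f x))
    (hf2 : Integrable (fun x => (f x) ^ 2)) {a : ℝ} (ha : 0 < a) :
    9 / (10 * a) - 3 / (2 * a ^ 3) * ∫ x, x ^ 2 * f x ≤ ∫ x, f x ^ 2 := by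
  have hE : Integrable fun x => (1 / a ^ 2) * epanechnikov (x / a) ^ 2 :=
    (integrable_epanechnikov_sq.comp_div ha.ne').const_mul _
  have hf := hint.const_mul (3 / (2 * a))
  have hv := hx2.const_mul (3 / (2 * a ^ 3))
  have hfv : Integrable fun x => 3 / (2 * a) * f x - 3 / (2 * a ^ 3) * (x ^ 2 * f x) :=
    hf.sub hv
  have hE_int : ∫ x, (1 / a ^ 2) * epanechnikov (x / a) ^ 2 = 3 / (5 * a) := by
    rw [integral_const_mul, Measure.integral_comp_div (fun x => epanechnikov x ^ 2),
      integral_epanechnikov_sq, abs_of_pos ha, smul_eq_mul]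
    field_simp
  calc 9 / (10 * a) - 3 / (2 * a ^ 3) * ∫ x, x ^ 2 * f x
      = ∫ x, (3 / (2 * a) * f x - 3 / (2 * a ^ 3) * (x ^ 2 * f x)
          - (1 / a ^ 2) * epanechnikov (x / a) ^ 2) := by
        rw [integral_sub hfv hE, integral_sub hf hv, integral_const_mul,
          integral_const_mul, htotal, hE_int]
        field_simp
        ring
    _ ≤ ∫ x, f x ^ 2 := by
        refine integral_mono (hfv.sub hE) hf2 fun x => ?_
        have h1 := mul_le_mul_of_nonneg_left (le_epanechnikov (x / a))
          (mul_nonneg (by positivity : 0 ≤ 2 / a) (hnn x))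
        have h2 := sq_nonneg (f x - 1 / a * epanechnikov (x / a))
        have h3 : 2 / a * f x * (3 / 4 * (1 - (x / a) ^ 2))
            = 3 / (2 * a) * f x - 3 / (2 * a ^ 3) * (x ^ 2 * f x) := by
          field_simp
          ring
        have h4 : (f x - 1 / a * epanechnikov (x / a)) ^ 2 = f x ^ 2
            - 2 / a * f x * epanechnikov (x / a) + 1 / a ^ 2 * epanechnikov (x / a) ^ 2 := by
          ring
        dsimp only
        linarith

/-- For a probability density `f` with mean zero, finite second moment and square-integrable,
`(∫ f²)² · (∫ x² f) ≥ 9/125`, with equality for the Epanechnikov density. -/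
theorem density_variational_inequality (f : ℝ → ℝ)
    (hmeas : Measurable f) (hnn : ∀ x, 0 ≤ f x)
    (hint : Integrable f) (htotal : ∫ x, f x = 1)
    (hx : Integrable (fun x => x * f x)) (hmean : ∫ x, x * f x = 0)
    (hx2 : Integrable (fun x => x ^ 2 * f x))
    (hf2 : Integrable (fun x => (f x) ^ 2)) :
    (9 : ℝ) / 125 ≤ (∫ x, (f x) ^ 2) ^ 2 * ∫ x, x ^ 2 * f x ∧
    (∫ x, (epanechnikov x) ^ 2) ^ 2 * ∫ x, x ^ 2 * epanechnikov x = 9 / 125 := by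
  refine ⟨?_, by rw [integral_epanechnikov_sq, integral_sq_mul_epanechnikov]; norm_num⟩
  have key (a : ℝ) (ha : 0 < a) := le_integral_sq_of_density hnn hint htotal hx2 hf2 ha
  have hV : 0 ≤ ∫ x, x ^ 2 * f x := integral_nonneg fun x => mul_nonneg (sq_nonneg x) (hnn x)
  have hA : 0 ≤ ∫ x, f x ^ 2 := integral_nonneg fun x => sq_nonneg _
  generalize ∫ x, x ^ 2 * f x = V at *
  generalize ∫ x, f x ^ 2 = A at *
  rcases hV.eq_or_lt with rfl | hV
  · have h := key (9 / (10 * (A + 1))) (by positivity)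
    have h' : 9 / (10 * (9 / (10 * (A + 1)))) = A + 1 := by field_simp
    rw [h'] at h
    linarith
  · obtain ⟨a, ha, haV⟩ : ∃ a, 0 < a ∧ a ^ 2 = 5 * V :=
      ⟨√(5 * V), by positivity, Real.sq_sqrt (by positivity)⟩
    obtain rfl : V = a ^ 2 / 5 := by linarith
    have h := key a ha
    have h' : 9 / (10 * a) - 3 / (2 * a ^ 3) * (a ^ 2 / 5) = 3 / (5 * a) := by
      field_simp
      ring
    rw [h'] at h
    calc (9 : ℝ) / 125 = (3 / (5 * a)) ^ 2 * (a ^ 2 / 5) := by field_simp; norm_num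
      _ ≤ A ^ 2 * (a ^ 2 / 5) := by gcongr
end

section
/- Let K : ℝ → [0,∞) be continuous with K(x) = 0 for x ∉ [0,1], K(x) = K(1−x) for all x ∈ [0,1], and ∫₀¹ K(x) dx = 1 (i.e., K belongs to the class K₂). Then (∫₀¹ K(x)^2 dx)^2 · (∫₀¹ (x − 1/2)^2·K(x) dx) ≥ 9/125, with equality for the optimal time-smoothing kernel K₂ᵒᵖᵗ(x) = 6·x·(1−x) on [0,1]. -/
open Real MeasureTheory

/-- The square of the Epanechnikov profile integrates to `16 s ^ 5 / 15`. -/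
lemma integral_sq_parabola (s : ℝ) :
    ∫ x in (1 / 2 - s)..(1 / 2 + s), (s ^ 2 - (x - 1 / 2) ^ 2) ^ 2 = 16 * s ^ 5 / 15 := by
  have hd : ∀ x ∈ Set.uIcc (1 / 2 - s) (1 / 2 + s),
      HasDerivAt (fun x : ℝ => s ^ 4 * (x - 1 / 2) - 2 * s ^ 2 * (x - 1 / 2) ^ 3 / 3
        + (x - 1 / 2) ^ 5 / 5) ((s ^ 2 - (x - 1 / 2) ^ 2) ^ 2) x := by
    intro x _
    have h := (hasDerivAt_id x).sub_const (1 / 2 : ℝ)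
    have h' := ((h.const_mul (s ^ 4)).sub (((h.pow 3).const_mul (2 * s ^ 2)).div_const 3)).add
      ((h.pow 5).div_const 5)
    refine h'.congr_deriv ?_
    simp only [id]
    push_cast
    ring
  rw [intervalIntegral.integral_eq_sub_of_hasDerivAt hd
    (Continuous.intervalIntegrable (by fun_prop) _ _)]
  ring

/-- Expanding the square of the distance from `K` to `c * (s ^ 2 - (x - 1 / 2) ^ 2)₊` bounds
the energy of a kernel from below in terms of its variance. -/
lemma energy_lower_bound (K : ℝ → ℝ)
    (hcont : Continuous K) (hnn : ∀ x, 0 ≤ K x)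
    (hsupp : ∀ x, x ∉ Set.Icc (0 : ℝ) 1 → K x = 0)
    (hint : ∫ x in (0 : ℝ)..1, K x = 1) {s c : ℝ} (hs : 0 < s) (hc : 0 < c) :
    2 * c * (s ^ 2 - ∫ x in (0 : ℝ)..1, (x - 1 / 2) ^ 2 * K x) - c ^ 2 * (16 * s ^ 5 / 15) ≤
      ∫ x in (0 : ℝ)..1, (K x) ^ 2 := by
  have hline : ∀ f : ℝ → ℝ, (∀ x, K x = 0 → f x = 0) →
      ∫ x in (0 : ℝ)..1, f x = ∫ x, f x := by
    intro f hf
    rw [intervalIntegral.integral_of_le zero_le_one, ← integral_Icc_eq_integral_Ioc]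
    exact setIntegral_eq_integral_of_forall_compl_eq_zero fun x hx => hf x (hsupp x hx)
  have hI : ∀ f : ℝ → ℝ, Continuous f → (∀ x, K x = 0 → f x = 0) → Integrable f := by
    intro f hf hf0
    exact hf.integrable_of_hasCompactSupport
      (HasCompactSupport.intro isCompact_Icc fun x hx => hf0 x (hsupp x hx))
  have i1 := hI (fun x => K x) (by fun_prop) (by simp)
  have i2 := hI (fun x => K x ^ 2) (by fun_prop) (by simp)
  have i3 := hI (fun x => (x - 1 / 2) ^ 2 * K x) (by fun_prop) (by intro x hx; simp [hx])
  have i4 : Integrable fun x => s ^ 2 * K x - (x - 1 / 2) ^ 2 * K x := (i1.const_mul _).sub i3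
  rw [hline _ (by simp)] at hint
  rw [hline (fun x => K x ^ 2) (by simp),
    hline (fun x => (x - 1 / 2) ^ 2 * K x) (by intro x hx; simp [hx])]
  set J := Set.Ioc (1 / 2 - s) (1 / 2 + s) with hJ
  set g : ℝ → ℝ := J.indicator fun x => (s ^ 2 - (x - 1 / 2) ^ 2) ^ 2 with hg
  have ig : Integrable g := by
    rw [hg, integrable_indicator_iff measurableSet_Ioc]
    exact (Continuous.integrableOn_Icc (by fun_prop)).mono_set Set.Ioc_subset_Icc_self
  have eg : ∫ x, g x = 16 * s ^ 5 / 15 := by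
    rw [hg, integral_indicator measurableSet_Ioc, ← integral_sq_parabola,
      intervalIntegral.integral_of_le (by linarith)]
  have key : ∫ x, (2 * c * (s ^ 2 * K x - (x - 1 / 2) ^ 2 * K x) - c ^ 2 * g x) ≤
      ∫ x, K x ^ 2 := by
    refine integral_mono ((i4.const_mul _).sub (ig.const_mul _)) i2 ?_
    intro x
    by_cases hx : x ∈ J
    · simp only [hg, Set.indicator_of_mem hx]
      nlinarith [sq_nonneg (K x - c * (s ^ 2 - (x - 1 / 2) ^ 2))]
    · simp only [hg, Set.indicator_of_notMem hx]
      have h : s ^ 2 ≤ (x - 1 / 2) ^ 2 := by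
        rw [hJ, Set.mem_Ioc, not_and_or, not_lt, not_le] at hx
        rcases hx with hx | hx <;> nlinarith
      have h2 : 0 ≤ c * (((x - 1 / 2) ^ 2 - s ^ 2) * K x) :=
        mul_nonneg hc.le (mul_nonneg (by linarith) (hnn x))
      nlinarith [sq_nonneg (K x)]
  rw [integral_sub (i4.const_mul _) (ig.const_mul _),
    integral_const_mul, integral_sub (i1.const_mul _) i3, integral_const_mul,
    integral_const_mul, hint, eg, mul_one] at key
  exact key

/-- For any kernel `K` in the class `K₂` (continuous, nonnegative, supported on `[0,1]`,
symmetric about `1/2`, integrating to one), `(∫₀¹ K²)² · ∫₀¹ (x-1/2)² K(x) dx ≥ 9/125`,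
with equality for the optimal time-smoothing kernel `K₂ᵒᵖᵗ(x) = 6x(1-x)`. -/
theorem K2_kernel_variational_inequality (K : ℝ → ℝ)
    (hcont : Continuous K) (hnn : ∀ x, 0 ≤ K x)
    (hsupp : ∀ x, x ∉ Set.Icc (0 : ℝ) 1 → K x = 0)
    (hsym : ∀ x ∈ Set.Icc (0 : ℝ) 1, K x = K (1 - x))
    (hint : ∫ x in (0 : ℝ)..1, K x = 1) :
    (9 : ℝ) / 125 ≤
      (∫ x in (0 : ℝ)..1, (K x) ^ 2) ^ 2 * ∫ x in (0 : ℝ)..1, (x - 1 / 2) ^ 2 * K x ∧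
    (∫ x in (0 : ℝ)..1, (6 * x * (1 - x)) ^ 2) ^ 2 *
        ∫ x in (0 : ℝ)..1, (x - 1 / 2) ^ 2 * (6 * x * (1 - x)) = 9 / 125 := by
  constructor
  · have hE := fun s (hs : 0 < s) => energy_lower_bound K hcont hnn hsupp hint hs
      (c := 3 / (4 * s ^ 3)) (by positivity)
    have hV : 0 ≤ ∫ x in (0 : ℝ)..1, (x - 1 / 2) ^ 2 * K x :=
      intervalIntegral.integral_nonneg zero_le_one fun x _ => mul_nonneg (sq_nonneg _) (hnn x)
    have hA : 0 ≤ ∫ x in (0 : ℝ)..1, (K x) ^ 2 :=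
      intervalIntegral.integral_nonneg zero_le_one fun x _ => sq_nonneg _
    generalize (∫ x in (0 : ℝ)..1, (x - 1 / 2) ^ 2 * K x) = V at *
    generalize (∫ x in (0 : ℝ)..1, (K x) ^ 2) = A at *
    rcases hV.eq_or_lt with rfl | hV
    · have h := hE (9 / (10 * (A + 1))) (by positivity)
      have e : 2 * (3 / (4 * (9 / (10 * (A + 1))) ^ 3)) * ((9 / (10 * (A + 1))) ^ 2 - 0)
          - (3 / (4 * (9 / (10 * (A + 1))) ^ 3)) ^ 2 * (16 * (9 / (10 * (A + 1))) ^ 5 / 15)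
          = A + 1 := by
        have : A + 1 ≠ 0 := by positivity
        field_simp
        ring
      linarith
    · obtain ⟨s, hs, rfl⟩ : ∃ s : ℝ, 0 < s ∧ s ^ 2 / 5 = V :=
        ⟨√(5 * V), by positivity, by rw [Real.sq_sqrt (by positivity)]; ring⟩
      have h := hE s hs
      have e : 2 * (3 / (4 * s ^ 3)) * (s ^ 2 - s ^ 2 / 5)
          - (3 / (4 * s ^ 3)) ^ 2 * (16 * s ^ 5 / 15) = 3 / (5 * s) := by
        field_simp
        ring
      rw [e] at h
      calc (9 : ℝ) / 125 = (3 / (5 * s)) ^ 2 * (s ^ 2 / 5) := by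
            field_simp
            norm_num
        _ ≤ A ^ 2 * (s ^ 2 / 5) := by gcongr
  · have h1 : ∫ x in (0 : ℝ)..1, (6 * x * (1 - x)) ^ 2 = 6 / 5 := by
      have e : ∀ x : ℝ, (6 * x * (1 - x)) ^ 2 = 36 * (1 / 2 ^ 2 - (x - 1 / 2) ^ 2) ^ 2 := by
        intro x; ring
      have h := integral_sq_parabola (1 / 2)
      norm_num at h
      simp only [e, intervalIntegral.integral_const_mul]
      norm_num
      rw [h]
      norm_num
    have h2 : ∫ x in (0 : ℝ)..1, (x - 1 / 2) ^ 2 * (6 * x * (1 - x)) = 1 / 20 := by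
      have hd : ∀ x ∈ Set.uIcc (0 : ℝ) 1,
          HasDerivAt (fun x : ℝ => (x - 1 / 2) ^ 3 / 2 - 6 * (x - 1 / 2) ^ 5 / 5)
            ((x - 1 / 2) ^ 2 * (6 * x * (1 - x))) x := by
        intro x _
        have h := (hasDerivAt_id x).sub_const (1 / 2 : ℝ)
        refine (((h.pow 3).div_const 2).sub
          (((h.pow 5).const_mul 6).div_const 5)).congr_deriv ?_
        simp only [id]
        push_cast
        ring
      rw [intervalIntegral.integral_eq_sub_of_hasDerivAt hd
        (Continuous.intervalIntegrable (by fun_prop) _ _)]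
      norm_num
    rw [h1, h2]
    norm_num
end

section
/- Let W : ℝ → [0,∞) be an even measurable function with ∫ W = 1, ∫ ω^2·W(ω) dω < ∞ and ∫ W(ω)^2 dω < ∞, and define K(x) = ∫ W(ω)·cos(x·ω) dω. Then ((1/2)·∫ ω^2·W(ω) dω) · (∫ K(x)^2 dx)^2 ≥ 18·π^2/125, with equality when W(ω) = (5/(8π))·(1 − (5ω/(6π))^2) for |ω| ≤ 6π/5 and W(ω) = 0 otherwise, in which case K is the quadratic spectral kernel. -/
open Real MeasureTheory

/-- The quadratic spectral window: the rescaled parabolic density on `[-6π/5, 6π/5]`. -/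
noncomputable def WQS (ω : ℝ) : ℝ :=
  if |ω| ≤ 6 * Real.pi / 5 then (5 / (8 * Real.pi)) * (1 - (5 * ω / (6 * Real.pi)) ^ 2) else 0

open FourierTransform SchwartzMap in
/-- On `L¹ ∩ L²` the `L²` Fourier transform is given by the Fourier integral. -/
theorem fourier_toLp_ae_eq {f : ℝ → ℂ} (h1 : Integrable f) (h2 : MemLp f 2) :
    (𝓕 (h2.toLp f) : Lp ℂ 2 (volume : Measure ℝ)) =ᵐ[volume] 𝓕 f := by
  have hcont : Continuous (𝓕 f) :=
    VectorFourier.fourierIntegral_continuous Real.continuous_fourierChar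
      (L := innerₗ ℝ) continuous_inner h1
  refine ae_eq_of_integral_contDiff_smul_eq
    ((Lp.memLp (𝓕 (h2.toLp f))).locallyIntegrable one_le_two) hcont.locallyIntegrable ?_
  intro g g_smooth g_cpt
  have hg₁ : HasCompactSupport (Complex.ofRealCLM ∘ g) := g_cpt.comp_left rfl
  have hg₂ : ContDiff ℝ (↑(⊤ : ℕ∞)) (Complex.ofRealCLM ∘ g) := by fun_prop
  set φ : 𝓢(ℝ, ℂ) := hg₁.toSchwartzMap hg₂ with hφ
  have key := congrArg (fun T : 𝓢'(ℝ, ℂ) => T φ)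
    (Lp.fourier_toTemperedDistribution_eq (h2.toLp f))
  simp only [TemperedDistribution.fourier_apply, Lp.toTemperedDistribution_apply] at key
  have flip := VectorFourier.integral_fourierIntegral_smul_eq_flip (L := innerₗ ℝ)
    Real.continuous_fourierChar continuous_inner (φ.integrable (μ := volume)) h1
  calc ∫ x, g x • (𝓕 (h2.toLp f) : Lp ℂ 2 (volume : Measure ℝ)) x
      = ∫ x, φ x • (𝓕 (h2.toLp f) : Lp ℂ 2 (volume : Measure ℝ)) x := by
        simp [hφ]
    _ = ∫ x, (𝓕 φ) x • (h2.toLp f) x := key.symm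
    _ = ∫ x, (𝓕 φ) x • f x := by
        refine integral_congr_ae ?_
        filter_upwards [h2.coeFn_toLp] with x hx
        rw [hx]
    _ = ∫ x, φ x • 𝓕 f x := by
        rw [flip_innerₗ] at flip
        exact flip
    _ = ∫ x, g x • 𝓕 f x := by simp [hφ]

open FourierTransform in
/-- Plancherel's theorem for functions in `L¹ ∩ L²`. -/
theorem integral_norm_sq_fourier {f : ℝ → ℂ} (h1 : Integrable f) (h2 : MemLp f 2) :
    ∫ x, ‖𝓕 f x‖ ^ 2 = ∫ x, ‖f x‖ ^ 2 := by
  have aux (g : Lp ℂ 2 (volume : Measure ℝ)) : ‖g‖ ^ 2 = ∫ x, ‖g x‖ ^ 2 := by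
    have h := L2.inner_def (𝕜 := ℂ) g g
    rw [inner_self_eq_norm_sq_to_K] at h
    simp only [inner_self_eq_norm_sq_to_K] at h
    exact_mod_cast h
  have h := aux (𝓕 (h2.toLp f))
  rw [Lp.norm_fourier_eq, aux] at h
  calc ∫ x, ‖𝓕 f x‖ ^ 2 = ∫ x, ‖(𝓕 (h2.toLp f) : Lp ℂ 2 (volume : Measure ℝ)) x‖ ^ 2 := by
        refine integral_congr_ae ?_
        filter_upwards [fourier_toLp_ae_eq h1 h2] with x hx
        rw [hx]
    _ = ∫ x, ‖h2.toLp f x‖ ^ 2 := h.symm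
    _ = ∫ x, ‖f x‖ ^ 2 := by
        refine integral_congr_ae ?_
        filter_upwards [h2.coeFn_toLp] with x hx
        rw [hx]

open FourierTransform in
/-- The Fourier transform of an even real function is its cosine transform. -/
theorem fourier_ofReal_of_even {W : ℝ → ℝ} (heven : ∀ ω, W (-ω) = W ω) (hint : Integrable W)
    (x : ℝ) :
    𝓕 (fun ω => (W ω : ℂ)) x = ((∫ ω, W ω * Real.cos (2 * Real.pi * x * ω) : ℝ) : ℂ) := by
  have hc : Integrable fun ω => W ω * Real.cos (2 * Real.pi * x * ω) :=
    hint.mul_bdd (c := 1) (by fun_prop)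
      (Filter.Eventually.of_forall fun ω => Real.abs_cos_le_one _)
  have hs : Integrable fun ω => W ω * Real.sin (2 * Real.pi * x * ω) :=
    hint.mul_bdd (c := 1) (by fun_prop)
      (Filter.Eventually.of_forall fun ω => Real.abs_sin_le_one _)
  have hs0 : ∫ ω, W ω * Real.sin (2 * Real.pi * x * ω) = 0 := by
    have h := integral_neg_eq_self (fun ω => W ω * Real.sin (2 * Real.pi * x * ω)) volume
    simp only [heven, mul_neg, Real.sin_neg, integral_neg] at h
    linarith
  rw [Real.fourier_real_eq_integral_exp_smul]
  calc ∫ ω, Complex.exp (↑(-2 * Real.pi * ω * x) * Complex.I) • (W ω : ℂ)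
      = ∫ ω, (((W ω * Real.cos (2 * Real.pi * x * ω) : ℝ) : ℂ)
          - ((W ω * Real.sin (2 * Real.pi * x * ω) : ℝ) : ℂ) * Complex.I) := by
        refine integral_congr_ae (Filter.Eventually.of_forall fun ω => ?_)
        have : -2 * Real.pi * ω * x = -(2 * Real.pi * x * ω) := by ring
        simp only [smul_eq_mul]
        rw [this, Complex.exp_mul_I, ← Complex.ofReal_cos, ← Complex.ofReal_sin, Real.cos_neg,
          Real.sin_neg]
        push_cast
        ring
    _ = _ := by
        rw [integral_sub hc.ofReal (hs.ofReal.mul_const _), integral_mul_const,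
          integral_complex_ofReal, integral_complex_ofReal, hs0]
        simp

/-- Plancherel's theorem for cosine transforms of even functions. -/
theorem integral_sq_cosine_transform {W : ℝ → ℝ} (heven : ∀ ω, W (-ω) = W ω)
    (hint : Integrable W) (hW2 : Integrable fun ω => W ω ^ 2) :
    ∫ x, (∫ ω, W ω * Real.cos (x * ω)) ^ 2 = 2 * Real.pi * ∫ ω, W ω ^ 2 := by
  have h2 : MemLp (fun ω => (W ω : ℂ)) 2 :=
    ((memLp_two_iff_integrable_sq hint.aestronglyMeasurable).2 hW2).ofReal
  have h := integral_norm_sq_fourier (f := fun ω => (W ω : ℂ)) hint.ofReal h2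
  simp_rw [fourier_ofReal_of_even heven hint] at h
  simp only [Complex.norm_real, Real.norm_eq_abs, sq_abs] at h
  have hscale := Measure.integral_comp_mul_left
    (fun x => (∫ ω, W ω * Real.cos (x * ω)) ^ 2) (2 * Real.pi)
  rw [h, abs_of_pos (by positivity), smul_eq_mul] at hscale
  rw [hscale]
  field_simp

/-- The parabolic probability density on `[-a, a]`. -/
noncomputable def parabolicDensity (a ω : ℝ) : ℝ :=
  if |ω| ≤ a then 3 / (4 * a) * (1 - (ω / a) ^ 2) else 0

theorem WQS_eq_parabolicDensity : WQS = parabolicDensity (6 * Real.pi / 5) := by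
  funext ω
  unfold WQS parabolicDensity
  congr 1
  field_simp
  ring

theorem mul_parabolicDensity_eq_indicator (a : ℝ) (g : ℝ → ℝ) :
    (fun ω => g ω * parabolicDensity a ω) =
      (Set.Icc (-a) a).indicator fun ω => g ω * (3 / (4 * a) * (1 - (ω / a) ^ 2)) := by
  funext ω
  simp only [parabolicDensity, Set.indicator_apply, Set.mem_Icc, abs_le, mul_ite, mul_zero]

theorem parabolicDensity_sq_eq_indicator (a : ℝ) :
    (fun ω => parabolicDensity a ω ^ 2) =
      (Set.Icc (-a) a).indicator fun ω => (3 / (4 * a) * (1 - (ω / a) ^ 2)) ^ 2 := by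
  funext ω
  simp only [parabolicDensity, Set.indicator_apply, Set.mem_Icc, abs_le, ite_pow]
  simp

theorem integrable_parabolicDensity (a : ℝ) : Integrable (parabolicDensity a) := by
  have h := mul_parabolicDensity_eq_indicator a fun _ => 1
  simp only [one_mul] at h
  change Integrable fun ω => parabolicDensity a ω
  rw [h, integrable_indicator_iff measurableSet_Icc]
  exact Continuous.integrableOn_Icc (by fun_prop)

theorem integrable_parabolicDensity_sq (a : ℝ) :
    Integrable fun ω => parabolicDensity a ω ^ 2 := by
  rw [parabolicDensity_sq_eq_indicator, integrable_indicator_iff measurableSet_Icc]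
  exact Continuous.integrableOn_Icc (by fun_prop)

theorem integral_parabolicDensity_sq {a : ℝ} (ha : 0 < a) :
    ∫ ω, parabolicDensity a ω ^ 2 = 3 / (5 * a) := by
  rw [parabolicDensity_sq_eq_indicator, integral_indicator measurableSet_Icc,
    integral_Icc_eq_integral_Ioc, ← intervalIntegral.integral_of_le (by linarith)]
  have : ∀ ω : ℝ, (3 / (4 * a) * (1 - (ω / a) ^ 2)) ^ 2 =
      9 / (16 * a ^ 2) - 9 / (8 * a ^ 4) * ω ^ 2 + 9 / (16 * a ^ 6) * ω ^ 4 := by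
    intro ω
    field_simp
    ring
  simp only [this]
  rw [intervalIntegral.integral_add, intervalIntegral.integral_sub] <;>
    try exact Continuous.intervalIntegrable (by fun_prop) _ _
  simp only [intervalIntegral.integral_const, intervalIntegral.integral_const_mul, integral_pow,
    smul_eq_mul]
  field_simp
  ring

theorem integral_sq_mul_parabolicDensity {a : ℝ} (ha : 0 < a) :
    ∫ ω, ω ^ 2 * parabolicDensity a ω = a ^ 2 / 5 := by
  rw [mul_parabolicDensity_eq_indicator, integral_indicator measurableSet_Icc,
    integral_Icc_eq_integral_Ioc, ← intervalIntegral.integral_of_le (by linarith)]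
  have : ∀ ω : ℝ, ω ^ 2 * (3 / (4 * a) * (1 - (ω / a) ^ 2)) =
      3 / (4 * a) * ω ^ 2 - 3 / (4 * a ^ 3) * ω ^ 4 := by
    intro ω
    field_simp
  simp only [this]
  rw [intervalIntegral.integral_sub] <;>
    try exact Continuous.intervalIntegrable (by fun_prop) _ _
  simp only [intervalIntegral.integral_const_mul, integral_pow]
  field_simp
  ring

/-- Among densities with given second moment, the parabolic one minimizes the `L²` norm. -/
theorem le_secondMoment_mul_integral_sq_sq {W : ℝ → ℝ} (hnn : ∀ ω, 0 ≤ W ω)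
    (hint : Integrable W) (htotal : ∫ ω, W ω = 1) (hω2 : Integrable fun ω => ω ^ 2 * W ω)
    (hW2 : Integrable fun ω => W ω ^ 2) :
    9 / 125 ≤ (∫ ω, ω ^ 2 * W ω) * (∫ ω, W ω ^ 2) ^ 2 := by
  set m := ∫ ω, ω ^ 2 * W ω with hm
  have hnn2 : ∀ ω, 0 ≤ ω ^ 2 * W ω := fun ω => mul_nonneg (sq_nonneg _) (hnn ω)
  have hm0 : 0 < m := by
    refine lt_of_le_of_ne (integral_nonneg hnn2) fun h0 => ?_
    have hae := (integral_eq_zero_iff_of_nonneg hnn2 hω2).1 h0.symm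
    have hW0 : W =ᵐ[volume] 0 := by
      filter_upwards [hae, Measure.ae_ne volume 0] with ω hω hne
      simpa [hne] using hω
    rw [integral_congr_ae hW0] at htotal
    simp at htotal
  obtain ⟨a, ha, ham⟩ : ∃ a : ℝ, 0 < a ∧ a ^ 2 = 5 * m :=
    ⟨√(5 * m), by positivity, Real.sq_sqrt (by positivity)⟩
  have hlow : 3 / (5 * a) ≤ ∫ ω, W ω ^ 2 := by
    have hmono : ∫ ω, (3 / (2 * a) * W ω - 3 / (2 * a ^ 3) * (ω ^ 2 * W ω)
        - parabolicDensity a ω ^ 2) ≤ ∫ ω, W ω ^ 2 := by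
      refine integral_mono (((hint.const_mul _).sub (hω2.const_mul _)).sub
        (integrable_parabolicDensity_sq a)) hW2 fun ω => ?_
      have hle : 3 / (4 * a) * (1 - (ω / a) ^ 2) ≤ parabolicDensity a ω := by
        unfold parabolicDensity
        split_ifs with h
        · exact le_rfl
        · refine mul_nonpos_of_nonneg_of_nonpos (by positivity) ?_
          have : a ^ 2 ≤ ω ^ 2 := by
            rw [← sq_abs ω]
            gcongr
            exact (not_le.1 h).le
          rw [div_pow, sub_nonpos, one_le_div (by positivity)]
          exact this
      have hmul := mul_le_mul_of_nonneg_left hle (hnn ω)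
      have hexp : 3 / (2 * a) * W ω - 3 / (2 * a ^ 3) * (ω ^ 2 * W ω) =
          2 * (W ω * (3 / (4 * a) * (1 - (ω / a) ^ 2))) := by
        field_simp
        ring
      simp only [hexp]
      nlinarith [sq_nonneg (W ω - parabolicDensity a ω)]
    rw [integral_sub (by exact (hint.const_mul _).sub (hω2.const_mul _))
        (integrable_parabolicDensity_sq a), integral_sub (hint.const_mul _) (hω2.const_mul _),
      integral_const_mul, integral_const_mul, htotal, integral_parabolicDensity_sq ha,
      ← hm] at hmono
    refine le_of_eq_of_le ?_ hmono
    rw [show m = a ^ 2 / 5 by linarith]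
    field_simp
    norm_num
  calc (9 : ℝ) / 125 = m * (3 / (5 * a)) ^ 2 := by
        rw [div_pow, mul_pow, ham]
        field_simp
        norm_num
    _ ≤ _ := by gcongr

/-- For kernels `K` arising as cosine transforms of even nonnegative spectral window
densities `W` with unit mass, finite second moment and square-integrable, the
kernel-dependent MSE factor satisfies `((1/2)∫ω²W)·(∫K²)² ≥ 18π²/125`, with equality for
the quadratic spectral window (in which case `K` is the QS kernel). -/
theorem qs_kernel_optimality (W : ℝ → ℝ)
    (hmeas : Measurable W) (hnn : ∀ ω, 0 ≤ W ω) (heven : ∀ ω, W (-ω) = W ω)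
    (hint : Integrable W) (htotal : ∫ ω, W ω = 1)
    (hω2 : Integrable (fun ω => ω ^ 2 * W ω))
    (hW2 : Integrable (fun ω => (W ω) ^ 2))
    (K : ℝ → ℝ) (hK : ∀ x, K x = ∫ ω, W ω * Real.cos (x * ω)) :
    18 * Real.pi ^ 2 / 125 ≤ ((1 / 2) * ∫ ω, ω ^ 2 * W ω) * (∫ x, (K x) ^ 2) ^ 2 ∧
    ((1 / 2) * ∫ ω, ω ^ 2 * WQS ω) *
        (∫ x, (∫ ω, WQS ω * Real.cos (x * ω)) ^ 2) ^ 2 = 18 * Real.pi ^ 2 / 125 := by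
  have hpi := Real.pi_pos
  have ha : 0 < 6 * Real.pi / 5 := by positivity
  constructor
  · simp only [hK, integral_sq_cosine_transform heven hint hW2]
    have h := le_secondMoment_mul_integral_sq_sq hnn hint htotal hω2 hW2
    calc 18 * Real.pi ^ 2 / 125 = 2 * Real.pi ^ 2 * (9 / 125) := by ring
      _ ≤ 2 * Real.pi ^ 2 * ((∫ ω, ω ^ 2 * W ω) * (∫ ω, W ω ^ 2) ^ 2) := by gcongr
      _ = _ := by ring
  · rw [WQS_eq_parabolicDensity, integral_sq_cosine_transform
      (fun ω => by simp [parabolicDensity, neg_div]) (integrable_parabolicDensity _)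
      (integrable_parabolicDensity_sq _), integral_sq_mul_parabolicDensity ha,
      integral_parabolicDensity_sq ha]
    field_simp
    norm_num
end

section
/- The quadratic spectral kernel K_QS belongs to the kernel class K₁: K_QS(0) = 1, K_QS(x) = K_QS(−x) for all x, |K_QS(x)| ≤ 1 for all x, K_QS is continuous on ℝ, and ∫ K_QS(x)^2 dx < ∞. -/
open Real MeasureTheory

/-- The quadratic spectral (QS) kernel. -/
noncomputable def KQS (x : ℝ) : ℝ :=
  if x = 0 then 1
  else (25 / (12 * Real.pi ^ 2 * x ^ 2)) *
    (Real.sin (6 * Real.pi * x / 5) / (6 * Real.pi * x / 5) - Real.cos (6 * Real.pi * x / 5))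

/-- The QS kernel in its angular variable, as an average of `sinc` over the unit ball of `ℝ³`. -/
lemma integral_three_mul_sq_mul_sinc {z : ℝ} (hz : z ≠ 0) :
    ∫ u in (0 : ℝ)..1, 3 * u ^ 2 * sinc (z * u) = 3 / z ^ 2 * (sin z / z - cos z) := by
  have hderiv (u : ℝ) : HasDerivAt (fun u => 3 / z ^ 3 * (sin (z * u) - z * u * cos (z * u)))
      (3 * u ^ 2 * sinc (z * u)) u := by
    have hlin : HasDerivAt (fun u : ℝ => z * u) z u := by
      simpa using (hasDerivAt_id u).const_mul z
    refine ((hlin.sin.sub (hlin.mul hlin.cos)).const_mul (3 / z ^ 3)).congr_deriv ?_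
    rcases eq_or_ne u 0 with rfl | hu
    · simp
    · rw [sinc_of_ne_zero (mul_ne_zero hz hu)]
      field_simp
      ring
  rw [intervalIntegral.integral_eq_sub_of_hasDerivAt (fun u _ => hderiv u)
    (Continuous.intervalIntegrable (by fun_prop) _ _)]
  simp only [mul_one, mul_zero, sin_zero, zero_mul, sub_zero]
  field_simp

lemma KQS_of_ne_zero {x : ℝ} (hx : x ≠ 0) :
    KQS x = 3 / (6 * π * x / 5) ^ 2 *
      (sin (6 * π * x / 5) / (6 * π * x / 5) - cos (6 * π * x / 5)) := by
  rw [KQS, if_neg hx]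
  congr 1
  field_simp
  norm_num

lemma KQS_eq_integral_sinc (x : ℝ) :
    KQS x = ∫ u in (0 : ℝ)..1, 3 * u ^ 2 * sinc (6 * π * x / 5 * u) := by
  rcases eq_or_ne x 0 with rfl | hx
  · simp [KQS, integral_pow]
    norm_num
  · rw [KQS_of_ne_zero hx, integral_three_mul_sq_mul_sinc (by positivity)]

lemma KQS_neg (x : ℝ) : KQS (-x) = KQS x := by
  simp only [KQS_eq_integral_sinc, mul_neg, neg_div, neg_mul, sinc_neg]

lemma continuous_KQS : Continuous KQS := by
  rw [funext KQS_eq_integral_sinc]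
  exact intervalIntegral.continuous_parametric_intervalIntegral_of_continuous'
    (by fun_prop) 0 1

lemma abs_KQS_le_one (x : ℝ) : |KQS x| ≤ 1 := by
  rw [KQS_eq_integral_sinc, ← Real.norm_eq_abs]
  calc ‖∫ u in (0 : ℝ)..1, 3 * u ^ 2 * sinc (6 * π * x / 5 * u)‖
      ≤ ∫ u in (0 : ℝ)..1, 3 * u ^ 2 := by
        refine intervalIntegral.norm_integral_le_of_norm_le zero_le_one
          (Filter.Eventually.of_forall fun u _ => ?_)
          (Continuous.intervalIntegrable (by fun_prop) _ _)
        rw [norm_mul, Real.norm_of_nonneg (by positivity : (0 : ℝ) ≤ 3 * u ^ 2)]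
        exact mul_le_of_le_one_right (by positivity) (abs_sinc_le_one _)
    _ = 1 := by
        rw [intervalIntegral.integral_const_mul, integral_pow]
        norm_num

lemma sq_mul_abs_KQS_le (x : ℝ) : (6 * π * x / 5) ^ 2 * |KQS x| ≤ 6 := by
  rcases eq_or_ne x 0 with rfl | hx
  · simp
  have hz : 6 * π * x / 5 ≠ 0 := by positivity
  rw [KQS_of_ne_zero hx]
  generalize 6 * π * x / 5 = z at hz ⊢
  rw [← sinc_of_ne_zero hz, abs_mul, abs_of_nonneg (by positivity : 0 ≤ 3 / z ^ 2), ← mul_assoc,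
    mul_div_cancel₀ _ (pow_ne_zero 2 hz)]
  linarith [abs_sub (sinc z) (cos z), abs_sinc_le_one z, abs_cos_le_one z]

lemma integrable_KQS_sq : Integrable (fun x => KQS x ^ 2) := by
  have hdom : Integrable (fun x : ℝ => 7 * (1 + (6 * π / 5 * x) ^ 2)⁻¹) :=
    (integrable_inv_one_add_sq.comp_mul_left' (by positivity)).const_mul 7
  refine hdom.mono' (continuous_KQS.pow 2).aestronglyMeasurable
    (Filter.Eventually.of_forall fun x => ?_)
  rw [Real.norm_of_nonneg (sq_nonneg _), ← div_eq_mul_inv, le_div_iff₀ (by positivity),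
    ← sq_abs, ← mul_div_right_comm]
  have hone := abs_KQS_le_one x
  have hdecay := sq_mul_abs_KQS_le x
  have hnonneg := abs_nonneg (KQS x)
  nlinarith [mul_le_mul hdecay hone hnonneg (by norm_num)]

/-- The QS kernel belongs to the class `K₁`: `K_QS(0) = 1`, it is even, bounded by `1`
in absolute value, continuous, and square-integrable. -/
theorem KQS_mem_K1 :
    KQS 0 = 1 ∧ (∀ x : ℝ, KQS x = KQS (-x)) ∧ (∀ x : ℝ, |KQS x| ≤ 1) ∧
    Continuous KQS ∧ Integrable (fun x => (KQS x) ^ 2) :=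
  ⟨if_pos rfl, fun x => (KQS_neg x).symm, abs_KQS_le_one, continuous_KQS, integrable_KQS_sq⟩
end
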